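/- Let D ⊆ ℂ be open and let p : B(0,1) → D be a bijective holomorphic map from the open unit disk B(0,1) = {w ∈ ℂ : |w| < 1} onto D with p(0) = z₀. For t ≥ 0 set D_t := p({w : |w| < e^{−t/2}}) and, for B > 0, A_{t,B} := p({w : e^{−(t+B)/2} < |w| < e^{−t/2}}). Then for every t ≥ 0, inf{ liminf_{B→0⁺} (1/B) ∫_{A_{t,B}} |f(z)|² dλ(z) : f holomorphic on D_t with f(z₀) = 1 } = π |p'(0)|² e^{−t}. In particular, e^t times this infimum is constant in t. -/

import Mathlib

open MeasureTheory Set Filter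
open scoped ENNReal NNReal Topology

theorem map_nhds_of_injOn {U : Set ℂ} (hU : IsOpen U) {f : ℂ → ℂ}
    (hf : DifferentiableOn ℂ f U) (hinj : InjOn f U) {a : ℂ} (ha : a ∈ U) :
    𝓝 (f a) ≤ map f (𝓝 a) := by
  refine (hf.analyticAt (hU.mem_nhds ha)).eventually_constant_or_nhds_le_map_nhds.resolve_left
    fun h => ?_
  have h1 : ∀ᶠ z in 𝓝 a, z = a := by
    filter_upwards [h, hU.mem_nhds ha] with z hz hzU using hinj hzU ha hz
  have h2 : ∀ᶠ z in 𝓝[≠] a, False := by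
    filter_upwards [h1.filter_mono nhdsWithin_le_nhds, self_mem_nhdsWithin] with z hz hz'
    exact hz' hz
  exact h2.exists.choose_spec

theorem continuousAt_invFunOn {U : Set ℂ} (hU : IsOpen U) {f : ℂ → ℂ}
    (hf : DifferentiableOn ℂ f U) (hinj : InjOn f U) {a : ℂ} (ha : a ∈ U) :
    ContinuousAt (Function.invFunOn f U) (f a) := by
  have key : Tendsto (Function.invFunOn f U) (map f (𝓝 a)) (𝓝 a) := by
    rw [tendsto_map'_iff]
    refine tendsto_id.congr' ?_
    filter_upwards [hU.mem_nhds ha] with z hz using (hinj.leftInvOn_invFunOn hz).symm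
  rw [ContinuousAt, hinj.leftInvOn_invFunOn ha]
  exact key.mono_left (map_nhds_of_injOn hU hf hinj ha)

theorem hasDerivAt_invFunOn {U : Set ℂ} (hU : IsOpen U) {f : ℂ → ℂ}
    (hf : DifferentiableOn ℂ f U) (hinj : InjOn f U) {a : ℂ} (ha : a ∈ U)
    (hd : deriv f a ≠ 0) :
    HasDerivAt (Function.invFunOn f U) (deriv f a)⁻¹ (f a) := by
  refine HasDerivAt.of_local_left_inverse (f := f) (continuousAt_invFunOn hU hf hinj ha) ?_ hd ?_
  · rw [hinj.leftInvOn_invFunOn ha]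
    exact (hf.differentiableAt (hU.mem_nhds ha)).hasDerivAt
  · refine (map_nhds_of_injOn hU hf hinj ha) ?_
    rw [mem_map]
    filter_upwards [hU.mem_nhds ha] with z hz
    exact congrArg f (hinj.leftInvOn_invFunOn hz)

/-- An injective holomorphic function has nowhere vanishing derivative. -/
theorem deriv_ne_zero_of_injOn {U : Set ℂ} (hU : IsOpen U) {f : ℂ → ℂ}
    (hf : DifferentiableOn ℂ f U) (hinj : InjOn f U) {a : ℂ} (ha : a ∈ U) :
    deriv f a ≠ 0 := by
  have hfa := hf.analyticAt (hU.mem_nhds ha)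
  have hne : ∀ᶠ z in 𝓝[≠] a, deriv f z ≠ 0 := by
    refine hfa.deriv.eventually_eq_zero_or_eventually_ne_zero.resolve_left fun h => ?_
    obtain ⟨r, hr, hball⟩ := Metric.eventually_nhds_iff_ball.1 (h.and (hU.mem_nhds ha))
    have hconst : ∀ z ∈ Metric.ball a r, f z = f a := fun z hz =>
      Metric.isOpen_ball.is_const_of_deriv_eq_zero (convex_ball a r).isPreconnected
        (hf.mono fun w hw => (hball w hw).2) (fun w hw => (hball w hw).1) hz
        (Metric.mem_ball_self hr)
    have h1 : ∀ᶠ z in 𝓝[≠] a, False := by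
      filter_upwards [nhdsWithin_le_nhds (Metric.ball_mem_nhds a hr), self_mem_nhdsWithin]
        with z hz hz'
      exact hz' (hinj (hball z hz).2 ha (hconst z hz))
    exact h1.exists.choose_spec
  have hq : ∀ᶠ w in 𝓝[≠] (f a), DifferentiableAt ℂ (Function.invFunOn f U) w := by
    rw [eventually_nhdsWithin_iff] at hne ⊢
    refine (map_nhds_of_injOn hU hf hinj ha) ?_
    rw [mem_map]
    filter_upwards [hne, hU.mem_nhds ha] with z hz hzU hza
    exact (hasDerivAt_invFunOn hU hf hinj hzU
      (hz fun h => hza (congrArg f h))).differentiableAt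
  have hqa := (Complex.analyticAt_of_differentiable_on_punctured_nhds_of_continuousAt hq
    (continuousAt_invFunOn hU hf hinj ha)).differentiableAt.hasDerivAt
  have hcomp := hqa.comp a hfa.differentiableAt.hasDerivAt
  have hid : HasDerivAt (Function.invFunOn f U ∘ f) 1 a := by
    refine (hasDerivAt_id a).congr_of_eventuallyEq ?_
    filter_upwards [hU.mem_nhds ha] with z hz using hinj.leftInvOn_invFunOn hz
  intro h0
  have := hcomp.unique hid
  simp [h0] at this

theorem lintegral_image_eq_lintegral_enorm_deriv_sq_mul {U : Set ℂ} (hU : IsOpen U) {f : ℂ → ℂ}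
    (hf : DifferentiableOn ℂ f U) (hinj : InjOn f U) {s : Set ℂ} (hs : MeasurableSet s)
    (hsU : s ⊆ U) (g : ℂ → ℝ≥0∞) :
    ∫⁻ z in f '' s, g z = ∫⁻ w in s, ‖deriv f w‖ₑ ^ 2 * g (f w) := by
  rw [lintegral_image_eq_lintegral_abs_det_fderiv_mul volume hs
    (f' := fun w => (ContinuousLinearMap.toSpanSingleton ℂ (deriv f w)).restrictScalars ℝ) _
    (hinj.mono hsU)]
  · refine lintegral_congr fun w => ?_
    congr 1
    rw [← ofReal_norm, ← ENNReal.ofReal_pow (norm_nonneg _)]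
    simp [ContinuousLinearMap.det, LinearMap.det_restrictScalars,
      Algebra.norm_complex_eq, Complex.normSq_eq_norm_sq]
  · intro w hw
    exact ((hf.differentiableAt
      (hU.mem_nhds (hsU hw))).hasDerivAt.hasFDerivAt.restrictScalars ℝ).hasFDerivWithinAt

theorem measurableSet_annulus (a b : ℝ) : MeasurableSet {w : ℂ | a < ‖w‖ ∧ ‖w‖ < b} :=
  ((isOpen_lt continuous_const continuous_norm).inter
    (isOpen_lt continuous_norm continuous_const)).measurableSet

theorem volume_annulus {a b : ℝ} (ha : 0 ≤ a) (hab : a ≤ b) :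
    volume {w : ℂ | a < ‖w‖ ∧ ‖w‖ < b} = ENNReal.ofReal (Real.pi * (b ^ 2 - a ^ 2)) := by
  have h : {w : ℂ | a < ‖w‖ ∧ ‖w‖ < b} = Metric.ball 0 b \ Metric.closedBall 0 a := by
    ext w
    simp [and_comm]
  rcases hab.eq_or_lt with rfl | hlt
  · have : {w : ℂ | a < ‖w‖ ∧ ‖w‖ < a} = ∅ := by
      ext w
      simp only [mem_ofPred_eq, mem_empty_iff_false, iff_false]
      intro h
      linarith [h.1, h.2]
    simp [this]
  rw [h, measure_sdiff (Metric.closedBall_subset_ball hlt)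
    Metric.isClosed_closedBall.measurableSet.nullMeasurableSet
    (measure_closedBall_lt_top).ne, Complex.volume_ball, Complex.volume_closedBall,
    ← ENNReal.ofReal_pow ha, ← ENNReal.ofReal_pow (ha.trans hab),
    ← ENNReal.ofReal_coe_nnreal, ← ENNReal.ofReal_mul (by positivity),
    ← ENNReal.ofReal_mul (by positivity), ← ENNReal.ofReal_sub _ (by positivity)]
  congr 1
  simp
  ring

theorem enorm_center_le_lintegral_circle {R r : ℝ} (hr : 0 < r) (hrR : r < R) {G : ℂ → ℂ}
    (hG : DifferentiableOn ℂ G (Metric.ball 0 R)) :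
    ENNReal.ofReal (2 * Real.pi) * ‖G 0‖ₑ ≤
      ∫⁻ θ in Ioo (-Real.pi) Real.pi, ‖G (Complex.polarCoord.symm (r, θ))‖ₑ := by
  have hmean : Real.circleAverage G 0 r = G 0 := by
    refine DiffContOnCl.circleAverage (DifferentiableOn.diffContOnCl ?_)
    refine hG.mono ?_
    rw [abs_of_pos hr, closure_ball _ hr.ne']
    exact Metric.closedBall_subset_ball hrR
  have hshift : ∫ θ in (0 : ℝ)..2 * Real.pi, G (circleMap 0 r θ) =
      ∫ θ in (-Real.pi)..Real.pi, G (circleMap 0 r θ) := by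
    have := ((periodic_circleMap 0 r).comp G).intervalIntegral_add_eq 0 (-Real.pi)
    simpa [show -Real.pi + 2 * Real.pi = Real.pi by ring] using this
  rw [Real.circleAverage_def, hshift] at hmean
  have h2 : (∫ θ in (-Real.pi)..Real.pi, G (circleMap 0 r θ)) = (2 * Real.pi) • G 0 := by
    rw [← hmean, smul_smul, mul_inv_cancel₀ (by positivity), one_smul]
  rw [intervalIntegral.integral_of_le (by linarith [Real.pi_pos]),
    integral_Ioc_eq_integral_Ioo] at h2
  calc ENNReal.ofReal (2 * Real.pi) * ‖G 0‖ₑ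
      = ‖∫ θ in Ioo (-Real.pi) Real.pi, G (circleMap 0 r θ)‖ₑ := by
        rw [h2, enorm_smul, Real.enorm_eq_ofReal (by positivity)]
    _ ≤ ∫⁻ θ in Ioo (-Real.pi) Real.pi, ‖G (circleMap 0 r θ)‖ₑ :=
        enorm_integral_le_lintegral_enorm _
    _ = _ := by
        refine lintegral_congr fun θ => ?_
        simp [Complex.polarCoord_symm_apply, circleMap, Complex.exp_mul_I]

theorem lintegral_Ioo_ofReal {a b : ℝ} (ha : 0 ≤ a) (hab : a ≤ b) :
    ∫⁻ r in Ioo a b, ENNReal.ofReal r = ENNReal.ofReal ((b ^ 2 - a ^ 2) / 2) := by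
  rw [← ofReal_integral_eq_lintegral_ofReal, ← integral_Ioc_eq_integral_Ioo,
    ← intervalIntegral.integral_of_le hab, integral_id]
  · exact (continuous_id.integrableOn_Icc).mono_set Ioo_subset_Icc_self
  · filter_upwards [ae_restrict_mem measurableSet_Ioo] with r hr using ha.trans hr.1.le

/-- Sub-mean value inequality over an annulus centred at `0`. -/
theorem enorm_center_le_lintegral_annulus {a b : ℝ} (ha : 0 ≤ a) (hab : a ≤ b) {G : ℂ → ℂ}
    (hG : DifferentiableOn ℂ G (Metric.ball 0 b)) :
    ENNReal.ofReal (Real.pi * (b ^ 2 - a ^ 2)) * ‖G 0‖ₑ ≤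
      ∫⁻ w in {w : ℂ | a < ‖w‖ ∧ ‖w‖ < b}, ‖G w‖ₑ := by
  set A : Set ℂ := {w : ℂ | a < ‖w‖ ∧ ‖w‖ < b}
  set F : ℝ × ℝ → ℝ≥0∞ := fun q =>
    ENNReal.ofReal q.1 * A.indicator (fun w => ‖G w‖ₑ) (Complex.polarCoord.symm q)
  have hmeas : Measurable (A.indicator (fun w => ‖G w‖ₑ)) := by
    have hA : MeasurableSet A := measurableSet_annulus a b
    have hc : ContinuousOn (fun w => ‖G w‖ₑ) A :=
      (hG.continuousOn.mono fun w hw => by simpa using hw.2).enorm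
    classical
    rw [← Set.piecewise_eq_indicator]
    exact hc.measurable_piecewise continuousOn_const hA
  have hF : Measurable F := by
    refine (ENNReal.measurable_ofReal.comp measurable_fst).mul (hmeas.comp ?_)
    have : (Complex.polarCoord.symm : ℝ × ℝ → ℂ) =
        fun q => (q.1 : ℂ) * (Real.cos q.2 + Real.sin q.2 * Complex.I) := by
      ext q
      rw [Complex.polarCoord_symm_apply]
    rw [this]
    fun_prop
  rw [← lintegral_indicator (measurableSet_annulus a b),
    ← Complex.lintegral_comp_polarCoord_symm]
  change _ ≤ ∫⁻ q in polarCoord.target, F q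
  have hsub : Ioo a b ×ˢ Ioo (-Real.pi) Real.pi ⊆ polarCoord.target := by
    rintro ⟨r, θ⟩ ⟨h1, h2⟩
    exact ⟨ha.trans_lt h1.1, h2⟩
  refine le_trans ?_ (lintegral_mono_set hsub)
  rw [Measure.volume_eq_prod, ← Measure.prod_restrict, lintegral_prod _ hF.aemeasurable]
  calc ENNReal.ofReal (Real.pi * (b ^ 2 - a ^ 2)) * ‖G 0‖ₑ
      = ∫⁻ r in Ioo a b, ENNReal.ofReal r * (ENNReal.ofReal (2 * Real.pi) * ‖G 0‖ₑ) := by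
        rw [lintegral_mul_const _ ENNReal.measurable_ofReal, lintegral_Ioo_ofReal ha hab,
          ← mul_assoc, ← ENNReal.ofReal_mul (by nlinarith)]
        congr 2
        ring
    _ ≤ _ := by
        refine setLIntegral_mono' measurableSet_Ioo fun r hr => ?_
        have hr0 : 0 < r := ha.trans_lt hr.1
        have : ∀ θ, F (r, θ) =
            ENNReal.ofReal r * ‖G (Complex.polarCoord.symm (r, θ))‖ₑ := by
          intro θ
          have hm : Complex.polarCoord.symm (r, θ) ∈ A := by
            simpa [A, abs_of_pos hr0] using hr
          simp only [F, indicator_of_mem hm]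
        simp_rw [this]
        rw [lintegral_const_mul' _ _ ENNReal.ofReal_ne_top]
        gcongr
        exact enorm_center_le_lintegral_circle hr0 hr.2 hG

theorem tendsto_annulus_area_div (t c : ℝ) :
    Tendsto (fun B : ℝ => ENNReal.ofReal (Real.pi * (Real.exp (-t / 2) ^ 2 -
        Real.exp (-(t + B) / 2) ^ 2)) * ENNReal.ofReal (c ^ 2) / ENNReal.ofReal B)
      (𝓝[>] 0) (𝓝 (ENNReal.ofReal (Real.pi * c ^ 2 * Real.exp (-t)))) := by
  have hsq : ∀ x : ℝ, Real.exp (-x / 2) ^ 2 = Real.exp (-x) := fun x => by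
    rw [← Real.exp_nat_mul]
    congr 1
    push_cast
    ring
  have hd : HasDerivAt (fun B : ℝ => -(Real.pi * c ^ 2 * Real.exp (-(t + B))))
      (Real.pi * c ^ 2 * Real.exp (-t)) 0 := by
    have h1 : HasDerivAt (fun B : ℝ => -(t + B)) (-1) 0 :=
      ((hasDerivAt_id (0 : ℝ)).const_add t).neg
    exact (h1.exp.const_mul (Real.pi * c ^ 2)).neg.congr_deriv (by simp)
  have hs := (hasDerivAt_iff_tendsto_slope.1 hd).mono_left
    (nhdsWithin_mono 0 fun x (hx : 0 < x) => hx.ne')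
  refine (ENNReal.tendsto_ofReal hs).congr' ?_
  filter_upwards [self_mem_nhdsWithin] with B hB
  have hB : 0 < B := hB
  rw [hsq, hsq, ← ENNReal.ofReal_mul' (sq_nonneg c), ← ENNReal.ofReal_div_of_pos hB,
    slope_def_field]
  congr 1
  simp
  ring

/-- For a simply connected domain `D` uniformized by `p : B(0,1) → D` with
`p(0) = z₀`, and `D_t = p({|w| < e^{−t/2}})`, `A_{t,B} = p({e^{−(t+B)/2} < |w| < e^{−t/2}})`,
the infimum over holomorphic `f` on `D_t` with `f(z₀) = 1` of
`liminf_{B→0⁺} (1/B) ∫_{A_{t,B}} |f|² dλ` equals `π |p'(0)|² e^{−t}` for every `t ≥ 0`;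
in particular `e^t` times this infimum is constant in `t`. -/
theorem stmt_10 (D : Set ℂ) (hD : IsOpen D) (p : ℂ → ℂ)
    (hp_bij : Set.BijOn p (Metric.ball 0 1) D)
    (hp_holo : DifferentiableOn ℂ p (Metric.ball 0 1))
    (z₀ : ℂ) (hz₀ : p 0 = z₀) :
    ∀ t : ℝ, 0 ≤ t →
      sInf {v : ℝ≥0∞ | ∃ f : ℂ → ℂ,
          DifferentiableOn ℂ f (p '' {w : ℂ | ‖w‖ < Real.exp (-t / 2)}) ∧
          f z₀ = 1 ∧
          v = Filter.liminf (fun B : ℝ =>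
            (∫⁻ z in p '' {w : ℂ | Real.exp (-(t + B) / 2) < ‖w‖ ∧
                ‖w‖ < Real.exp (-t / 2)}, (‖f z‖₊ : ℝ≥0∞) ^ 2) / ENNReal.ofReal B)
            (𝓝[>] (0 : ℝ))} =
        ENNReal.ofReal (Real.pi * ‖deriv p 0‖ ^ 2 * Real.exp (-t)) := by
  intro t ht
  have hU : IsOpen (Metric.ball (0 : ℂ) 1) := Metric.isOpen_ball
  have hinj := hp_bij.injOn
  have h0 : (0 : ℂ) ∈ Metric.ball (0 : ℂ) 1 := Metric.mem_ball_self one_pos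
  have hR1 : Real.exp (-t / 2) ≤ 1 := Real.exp_le_one_iff.2 (by linarith)
  have hball : {w : ℂ | ‖w‖ < Real.exp (-t / 2)} = Metric.ball 0 (Real.exp (-t / 2)) := by
    ext w
    simp
  have hsub : Metric.ball (0 : ℂ) (Real.exp (-t / 2)) ⊆ Metric.ball 0 1 :=
    Metric.ball_subset_ball hR1
  have hchange : ∀ (f : ℂ → ℂ) (B : ℝ),
      ∫⁻ z in p '' {w : ℂ | Real.exp (-(t + B) / 2) < ‖w‖ ∧ ‖w‖ < Real.exp (-t / 2)},
        (‖f z‖₊ : ℝ≥0∞) ^ 2 =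
      ∫⁻ w in {w : ℂ | Real.exp (-(t + B) / 2) < ‖w‖ ∧ ‖w‖ < Real.exp (-t / 2)},
        ‖(deriv p w * f (p w)) ^ 2‖ₑ := fun f B => by
    rw [lintegral_image_eq_lintegral_enorm_deriv_sq_mul hU hp_holo hinj
      (measurableSet_annulus _ _) fun w hw => hsub (by simpa using hw.2)]
    refine lintegral_congr fun w => ?_
    rw [enorm_pow, enorm_mul, mul_pow]
    rfl
  have hexp : ∀ B : ℝ, 0 < B → Real.exp (-(t + B) / 2) ≤ Real.exp (-t / 2) := fun B hB =>
    Real.exp_le_exp.2 (by linarith)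
  have hnorm : ‖deriv p 0 ^ 2‖ₑ = ENNReal.ofReal (‖deriv p 0‖ ^ 2) := by
    rw [← norm_pow, ofReal_norm]
  have hlim := tendsto_annulus_area_div t ‖deriv p 0‖
  refine le_antisymm (sInf_le ?_) (le_sInf ?_)
  · have hne : ∀ w ∈ Metric.ball (0 : ℂ) 1, deriv p w ≠ 0 := fun w hw =>
      deriv_ne_zero_of_injOn hU hp_holo hinj hw
    have hleft := hinj.leftInvOn_invFunOn
    refine ⟨fun z => deriv p 0 / deriv p (Function.invFunOn p (Metric.ball 0 1) z),
      ?_, ?_, ?_⟩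
    · rw [hball]
      rintro _ ⟨w, hw, rfl⟩
      have hw1 := hsub hw
      have hq := (hasDerivAt_invFunOn hU hp_holo hinj hw1 (hne w hw1)).differentiableAt
      have hdp : DifferentiableAt ℂ (deriv p) (Function.invFunOn p (Metric.ball 0 1) (p w)) := by
        rw [hleft hw1]
        exact (hp_holo.deriv hU).differentiableAt (hU.mem_nhds hw1)
      refine ((differentiableAt_const _).div (hdp.comp (p w) hq) ?_).differentiableWithinAt
      simp only [Function.comp_apply]
      rw [hleft hw1]
      exact hne w hw1
    · simp only [← hz₀]
      rw [hleft h0, div_self (hne 0 h0)]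
    · rw [← hlim.liminf_eq]
      refine liminf_congr ?_
      filter_upwards [self_mem_nhdsWithin] with B hB
      rw [hchange]
      congr 1
      rw [← hnorm, ← volume_annulus (Real.exp_pos _).le (hexp B hB), mul_comm,
        ← setLIntegral_const]
      refine setLIntegral_congr_fun (measurableSet_annulus _ _) fun w hw => ?_
      have hw1 : w ∈ Metric.ball (0 : ℂ) 1 := hsub (by simpa using hw.2)
      rw [hleft hw1, mul_div_cancel₀ _ (hne w hw1)]
  · rintro v ⟨f, hf, hf1, rfl⟩
    rw [← hlim.liminf_eq]
    refine liminf_le_liminf ?_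
    filter_upwards [self_mem_nhdsWithin] with B hB
    rw [hchange]
    refine ENNReal.div_le_div_right ?_ _
    have hG : DifferentiableOn ℂ (fun w => (deriv p w * f (p w)) ^ 2)
        (Metric.ball 0 (Real.exp (-t / 2))) := by
      rw [hball] at hf
      exact (((hp_holo.deriv hU).mono hsub).mul
        (hf.comp (hp_holo.mono hsub) (mapsTo_image _ _))).pow 2
    have := enorm_center_le_lintegral_annulus (Real.exp_pos _).le (hexp B hB) hG
    simpa only [hz₀, hf1, mul_one, hnorm] using this
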